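/- Let (V, ω) be a VOA of CFT type. If a ∈ V_{≥2} ∩ CV_CFT, then there exists a vertex algebra automorphism ψ ∈ Aut V such that ψ(pr_2(a)) = a. Consequently, the natural map (V_2 ∩ CV_CFT)/Aut_ω V → CV_CFT/Aut V between orbit sets is surjective. -/

import Mathlib

/-!
Common framework: vertex algebras, ℤ-graded (conformal) vertex algebras,
conformal vectors, automorphism groups, following Moriwaki,
"On classification of conformal vectors in vertex operator algebra and
the vertex algebra automorphism group".
-/

noncomputable section

open scoped BigOperators

/-- The generalized binomial coefficient `binom(m, i)` for `m : ℤ`, valued in a field `K`. -/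
def zBinom (K : Type*) [Field K] (m : ℤ) (i : ℕ) : K :=
  (∏ j ∈ Finset.range i, ((m : K) - (j : K))) / (Nat.factorial i : K)

/-- A vertex algebra over a field `K`: a `K`-vector space `V` equipped with bilinear
`n`-th products `a(n)b` (`n : ℤ`) and a vacuum vector `𝟙`, subject to the truncation
condition, the vacuum and creation axioms, and the Borcherds identity. -/
structure VA (K V : Type*) [Field K] [AddCommGroup V] [Module K V] where
  /-- the `n`-th product `a(n)b`, bilinear in `a` and `b` -/
  ncoef : ℤ → V →ₗ[K] V →ₗ[K] V
  /-- the vacuum vector `𝟙` -/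
  vac : V
  /-- truncation: `a(n)b = 0` for `n` sufficiently large -/
  trunc : ∀ a b : V, ∃ N : ℤ, ∀ n : ℤ, N ≤ n → ncoef n a b = 0
  /-- the vacuum axiom `Y(𝟙, z) = id`, i.e. `𝟙(n)a = δ_{n,-1} a` -/
  vac_ncoef : ∀ (n : ℤ) (a : V), ncoef n vac a = if n = -1 then a else 0
  /-- creation: `a(-1)𝟙 = a` -/
  ncoef_vac : ∀ a : V, ncoef (-1) a vac = a
  /-- creation: `a(n)𝟙 = 0` for `n ≥ 0` -/
  ncoef_vac_zero : ∀ n : ℤ, 0 ≤ n → ∀ a : V, ncoef n a vac = 0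
  /-- the Borcherds identity -/
  borcherds : ∀ (a b c : V) (p q m : ℤ),
    (∑ᶠ i : ℕ, zBinom K m i •
        ncoef (m + q - (i : ℤ)) (ncoef (p + (i : ℤ)) a b) c)
      = ∑ᶠ i : ℕ, ((-1 : K) ^ i * zBinom K p i) •
          (ncoef (m + p - (i : ℤ)) a (ncoef (q + (i : ℤ)) b c)
            - ((p.negOnePow : ℤ) : K) •
                ncoef (p + q - (i : ℤ)) b (ncoef (m + (i : ℤ)) a c))

namespace VA

variable {K V : Type*} [Field K] [AddCommGroup V] [Module K V]

/-- The translation operator `T a = a(-2)𝟙`. -/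
def T (A : VA K V) : V →ₗ[K] V := (A.ncoef (-2)).flip A.vac

/-- The eigenspace `V_n^a = {v ∈ V | a(1)v = n v}` of `a(1)`. -/
def eig (A : VA K V) (a : V) (n : ℤ) : Submodule K V :=
  LinearMap.ker (A.ncoef 1 a - (n : K) • (LinearMap.id : V →ₗ[K] V))

/-- `a` is a conformal vector: `a(1)a = 2a`, `a(3)a ∈ K𝟙`, `a(2)a = 0`, `a(n)a = 0`
for `n ≥ 4`, `a(0) = T`, and `a(1)` is semisimple with integer eigenvalues
(`V = ⊕_{n ∈ ℤ} V_n^a`). -/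
def IsConformal (A : VA K V) (a : V) : Prop :=
  A.ncoef 1 a a = (2 : K) • a ∧
  (∃ c : K, A.ncoef 3 a a = c • A.vac) ∧
  A.ncoef 2 a a = 0 ∧
  (∀ n : ℤ, 4 ≤ n → A.ncoef n a a = 0) ∧
  A.ncoef 0 a = A.T ∧
  DirectSum.IsInternal (A.eig a)

/-- `a` is a conformal vector of CFT type: `(V, a)` is a VOA of CFT type, i.e.
`V = ⊕_{n ∈ ℕ} V_n^a` with finite-dimensional pieces and `V_0^a = K𝟙`. -/
def IsConformalCFT (A : VA K V) (a : V) : Prop :=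
  A.IsConformal a ∧
  (∀ n : ℤ, n < 0 → A.eig a n = ⊥) ∧
  (∀ n : ℤ, FiniteDimensional K (A.eig a n)) ∧
  A.eig a 0 = Submodule.span K {A.vac}

/-- `a` is a conformal vector of strong CFT type: of CFT type and `a(2)V_1^a = 0`
(i.e. `L^a(1) V_1^a = 0`). -/
def IsConformalSCFT (A : VA K V) (a : V) : Prop :=
  A.IsConformalCFT a ∧ ∀ v ∈ A.eig a 1, A.ncoef 2 a v = 0

/-- A vertex algebra homomorphism: a linear map preserving all products and the vacuum. -/
structure IsVAHom (A : VA K V) (f : V → V) : Prop where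
  map_add : ∀ a b : V, f (a + b) = f a + f b
  map_smul : ∀ (c : K) (a : V), f (c • a) = c • f a
  map_ncoef : ∀ (n : ℤ) (a b : V), f (A.ncoef n a b) = A.ncoef n (f a) (f b)
  map_vac : f A.vac = A.vac

/-- A vertex algebra automorphism: a bijective vertex algebra homomorphism. -/
def IsVAAut (A : VA K V) (f : V → V) : Prop :=
  A.IsVAHom f ∧ Function.Bijective f

/-- A (two-sided) ideal of a vertex algebra. -/
def IsIdeal (A : VA K V) (I : Submodule K V) : Prop :=
  ∀ (n : ℤ) (a : V), ∀ b ∈ I, A.ncoef n a b ∈ I ∧ A.ncoef n b a ∈ I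

/-- A vertex algebra is simple if it has no ideals other than `0` and itself. -/
def IsSimple (A : VA K V) : Prop :=
  ∀ I : Submodule K V, A.IsIdeal I → I = ⊥ ∨ I = ⊤

end VA

/-- The exponential `exp f = Σ_{n≥0} f^n / n!` of an endomorphism, as a function
(meaningful for locally nilpotent `f`). -/
def expOp {K V : Type*} [Field K] [AddCommGroup V] [Module K V]
    (f : V →ₗ[K] V) (v : V) : V :=
  ∑ᶠ n : ℕ, (Nat.factorial n : K)⁻¹ • (f ^ n) v

/-- A ℤ-grading on a vertex algebra, making it a ℤ-graded vertex algebra: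
`V = ⊕_{n ∈ ℤ} V_n`, `V_n(k)V_m ⊆ V_{n+m-k-1}` and `𝟙 ∈ V_0`. -/
structure GradedVA {K V : Type*} [Field K] [AddCommGroup V] [Module K V] (A : VA K V) where
  /-- the grading subspaces `V_n` -/
  gr : ℤ → Submodule K V
  /-- `V = ⊕_{n ∈ ℤ} V_n` -/
  decomp : DirectSum.Decomposition gr
  /-- `𝟙 ∈ V_0` -/
  vac_mem : A.vac ∈ gr 0
  /-- `V_n(k)V_m ⊆ V_{n+m-k-1}` -/
  ncoef_mem : ∀ (n m k : ℤ), ∀ a ∈ gr n, ∀ b ∈ gr m, A.ncoef k a b ∈ gr (n + m - k - 1)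

namespace GradedVA

variable {K V : Type*} [Field K] [AddCommGroup V] [Module K V] {A : VA K V}

/-- The canonical projection `pr_n : V → V_n`. -/
def pr (G : GradedVA A) (n : ℤ) (v : V) : V :=
  letI := G.decomp
  (DirectSum.decompose G.gr v n : V)

/-- `V_{≥n} = ⊕_{i ≥ n} V_i`. -/
def ge (G : GradedVA A) (n : ℤ) : Submodule K V := ⨆ i ≥ n, G.gr i

/-- `V_{≤n} = ⊕_{i ≤ n} V_i`. -/
def le (G : GradedVA A) (n : ℤ) : Submodule K V := ⨆ i ≤ n, G.gr i

/-- `J_1(V) = {a ∈ V_1 | a(0) = 0}`. -/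
def J1 (G : GradedVA A) : Set V :=
  {a : V | a ∈ G.gr 1 ∧ A.ncoef 0 a = 0}

/-- `Aut⁺V`: automorphisms `f` with `f(V_n) ⊆ V_{≥n}` and `pr_n ∘ f|_{V_n} = id`. -/
def AutPlus (G : GradedVA A) (f : V → V) : Prop :=
  A.IsVAAut f ∧ ∀ n : ℤ, ∀ v ∈ G.gr n, f v ∈ G.ge n ∧ G.pr n (f v) = v

/-- `Aut⁻V`: automorphisms `f` with `f(V_n) ⊆ ⊕_{k ≤ n} V_k` and `pr_n ∘ f|_{V_n} = id`. -/
def AutMinus (G : GradedVA A) (f : V → V) : Prop :=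
  A.IsVAAut f ∧ ∀ n : ℤ, ∀ v ∈ G.gr n, f v ∈ G.le n ∧ G.pr n (f v) = v

/-- `Aut⁰V`: automorphisms `f` with `f(V_n) ⊆ V_n`. -/
def AutZero (G : GradedVA A) (f : V → V) : Prop :=
  A.IsVAAut f ∧ ∀ n : ℤ, ∀ v ∈ G.gr n, f v ∈ G.gr n

end GradedVA

/-- A ℤ-graded conformal vertex algebra: a ℤ-graded vertex algebra with a conformal
vector `ω ∈ V_2` whose modes `L(n) = ω(n+1)` satisfy the Virasoro relations, with
`L(0)v = n v` for `v ∈ V_n` and `L(-1) = T`. -/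
structure ConfGVA {K V : Type*} [Field K] [AddCommGroup V] [Module K V] (A : VA K V)
    extends GradedVA A where
  /-- the conformal vector -/
  ω : V
  ω_mem : ω ∈ gr 2
  /-- the Virasoro relations `[L(n), L(m)] = (n-m)L(n+m) + δ_{n+m,0}((n³-n)/12)c` -/
  virasoro : ∃ c : K, ∀ n m : ℤ,
    A.ncoef (n + 1) ω ∘ₗ A.ncoef (m + 1) ω - A.ncoef (m + 1) ω ∘ₗ A.ncoef (n + 1) ω
      = ((n : K) - (m : K)) • A.ncoef (n + m + 1) ω
        + (if n + m = 0 then ((n : K) ^ 3 - (n : K)) / 12 * c else 0)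
            • (LinearMap.id : V →ₗ[K] V)
  /-- `L(0) v = n v` for `v ∈ V_n` -/
  L0_grading : ∀ n : ℤ, ∀ v ∈ gr n, A.ncoef 1 ω v = (n : K) • v
  /-- `L(-1) = T` -/
  Lneg1_eq_T : A.ncoef 0 ω = A.T

namespace ConfGVA

variable {K V : Type*} [Field K] [AddCommGroup V] [Module K V] {A : VA K V}

abbrev pr (C : ConfGVA A) : ℤ → V → V := C.toGradedVA.pr
abbrev ge (C : ConfGVA A) : ℤ → Submodule K V := C.toGradedVA.ge
abbrev le (C : ConfGVA A) : ℤ → Submodule K V := C.toGradedVA.le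
abbrev J1 (C : ConfGVA A) : Set V := C.toGradedVA.J1
abbrev AutPlus (C : ConfGVA A) : (V → V) → Prop := C.toGradedVA.AutPlus
abbrev AutMinus (C : ConfGVA A) : (V → V) → Prop := C.toGradedVA.AutMinus
abbrev AutZero (C : ConfGVA A) : (V → V) → Prop := C.toGradedVA.AutZero

/-- `Aut_ω V`: the VOA automorphisms, i.e. the stabilizer of `ω` in `Aut V`. -/
def AutOmega (C : ConfGVA A) (f : V → V) : Prop :=
  A.IsVAAut f ∧ f C.ω = C.ω

/-- An invariant bilinear form on `(V, ω)`:
`(a(n)b, c) = (-1)^d Σ_{j≥0} (1/j!) (b, (L(1)^j a)(2d-n-2-j) c)` for `a ∈ V_d`, which is the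
coefficient form of `(Y(a,z)b, c) = (b, Y(e^{zL(1)}(-z^{-2})^{L(0)} a, z^{-1}) c)`. -/
def IsInvForm (C : ConfGVA A) (B : V →ₗ[K] V →ₗ[K] K) : Prop :=
  ∀ d : ℤ, ∀ a ∈ C.gr d, ∀ (b c : V) (n : ℤ),
    B (A.ncoef n a b) c
      = ((d.negOnePow : ℤ) : K) *
          ∑ᶠ j : ℕ, (Nat.factorial j : K)⁻¹ *
            B b (A.ncoef (2 * d - n - 2 - (j : ℤ)) ((A.ncoef 2 C.ω ^ j) a) c)

end ConfGVA

/-- A VOA of CFT type: a ℤ-graded conformal vertex algebra with `V = ⊕_{n ∈ ℕ} V_n`,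
`dim V_n < ∞`, and `V_0 = K𝟙`. -/
structure VOACFT {K V : Type*} [Field K] [AddCommGroup V] [Module K V] (A : VA K V)
    extends ConfGVA A where
  gr_neg : ∀ n : ℤ, n < 0 → gr n = ⊥
  gr_fd : ∀ n : ℤ, FiniteDimensional K (gr n)
  gr_zero : gr 0 = Submodule.span K {A.vac}

namespace VOACFT

variable {K V : Type*} [Field K] [AddCommGroup V] [Module K V] {A : VA K V}

abbrev pr (W : VOACFT A) : ℤ → V → V := W.toConfGVA.pr
abbrev ge (W : VOACFT A) : ℤ → Submodule K V := W.toConfGVA.ge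
abbrev le (W : VOACFT A) : ℤ → Submodule K V := W.toConfGVA.le
abbrev J1 (W : VOACFT A) : Set V := W.toConfGVA.J1
abbrev AutPlus (W : VOACFT A) : (V → V) → Prop := W.toConfGVA.AutPlus
abbrev AutMinus (W : VOACFT A) : (V → V) → Prop := W.toConfGVA.AutMinus
abbrev AutZero (W : VOACFT A) : (V → V) → Prop := W.toConfGVA.AutZero
abbrev AutOmega (W : VOACFT A) : (V → V) → Prop := W.toConfGVA.AutOmega
abbrev IsInvForm (W : VOACFT A) : (V →ₗ[K] V →ₗ[K] K) → Prop := W.toConfGVA.IsInvForm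

end VOACFT

/-- A VOA of strong CFT type: a VOA of CFT type with `L(1)V_1 = 0`. -/
structure VOAsCFT {K V : Type*} [Field K] [AddCommGroup V] [Module K V] (A : VA K V)
    extends VOACFT A where
  L1_V1 : ∀ v ∈ gr 1, A.ncoef 2 ω v = 0

namespace VOAsCFT

variable {K V : Type*} [Field K] [AddCommGroup V] [Module K V] {A : VA K V}

abbrev pr (W : VOAsCFT A) : ℤ → V → V := W.toVOACFT.pr
abbrev ge (W : VOAsCFT A) : ℤ → Submodule K V := W.toVOACFT.ge
abbrev le (W : VOAsCFT A) : ℤ → Submodule K V := W.toVOACFT.le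
abbrev J1 (W : VOAsCFT A) : Set V := W.toVOACFT.J1
abbrev AutPlus (W : VOAsCFT A) : (V → V) → Prop := W.toVOACFT.AutPlus
abbrev AutMinus (W : VOAsCFT A) : (V → V) → Prop := W.toVOACFT.AutMinus
abbrev AutZero (W : VOAsCFT A) : (V → V) → Prop := W.toVOACFT.AutZero
abbrev AutOmega (W : VOAsCFT A) : (V → V) → Prop := W.toVOACFT.AutOmega
abbrev IsInvForm (W : VOAsCFT A) : (V →ₗ[K] V →ₗ[K] K) → Prop := W.toVOACFT.IsInvForm

end VOAsCFT

end

noncomputable section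

section zBinom

variable {K : Type*} [Field K]

lemma zBinom_zero_right (m : ℤ) : zBinom K m 0 = 1 := by simp [zBinom]

lemma zBinom_natCast_of_lt {m i : ℕ} (h : m < i) : zBinom K m i = 0 := by
  unfold zBinom
  rw [Finset.prod_eq_zero (Finset.mem_range.2 h) (by simp), zero_div]

lemma zBinom_one_right (m : ℤ) : zBinom K m 1 = m := by simp [zBinom]

lemma zBinom_neg_one [CharZero K] (i : ℕ) : zBinom K (-1) i = (-1) ^ i := by
  induction i with
  | zero => simp [zBinom]
  | succ i ih =>
    unfold zBinom at ih ⊢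
    have h1 : (Nat.factorial i : K) ≠ 0 := by exact_mod_cast Nat.factorial_ne_zero i
    have h2 : (i : K) + 1 ≠ 0 := by exact_mod_cast Nat.succ_ne_zero i
    rw [div_eq_iff h1] at ih
    rw [Finset.prod_range_succ, ih, Nat.factorial_succ]
    push_cast
    field_simp
    ring

end zBinom

namespace VA

variable {K V : Type*} [Field K] [AddCommGroup V] [Module K V] (A : VA K V)

lemma T_apply (v : V) : A.T v = A.ncoef (-2) v A.vac := rfl

lemma mem_eig {a v : V} {n : ℤ} : v ∈ A.eig a n ↔ A.ncoef 1 a v = (n : K) • v := by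
  simp [eig, sub_eq_zero]

lemma commutator (a b c : V) (m : ℕ) (q : ℤ) :
    A.ncoef m a (A.ncoef q b c) - A.ncoef q b (A.ncoef m a c)
      = ∑ i ∈ Finset.range (m + 1),
          zBinom K m i • A.ncoef (m + q - i) (A.ncoef i a b) c := by
  have h := A.borcherds a b c 0 q m
  rw [finsum_eq_sum_of_support_subset (s := Finset.range (m + 1)),
    finsum_eq_single _ 0] at h
  · simpa [zBinom_zero_right] using h.symm
  · intro i hi
    have := zBinom_natCast_of_lt (K := K) (Nat.pos_of_ne_zero hi)
    simp only [Nat.cast_zero] at this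
    simp [this]
  · intro i hi
    by_contra hn
    apply hi
    have : m < i := by simpa using hn
    simp [zBinom_natCast_of_lt this]

lemma commutator_zero (a b c : V) (q : ℤ) :
    A.ncoef 0 a (A.ncoef q b c) - A.ncoef q b (A.ncoef 0 a c)
      = A.ncoef q (A.ncoef 0 a b) c := by
  simpa [zBinom_zero_right] using A.commutator a b c 0 q

lemma commutator_one (a b c : V) (q : ℤ) :
    A.ncoef 1 a (A.ncoef q b c) - A.ncoef q b (A.ncoef 1 a c)
      = A.ncoef (q + 1) (A.ncoef 0 a b) c + A.ncoef q (A.ncoef 1 a b) c := by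
  have h := A.commutator a b c 1 q
  rw [Finset.sum_range_succ, Finset.sum_range_one] at h
  simpa [zBinom_zero_right, zBinom_one_right, add_comm] using h

lemma commutator_two [CharZero K] (a b c : V) (q : ℤ) :
    A.ncoef 2 a (A.ncoef q b c) - A.ncoef q b (A.ncoef 2 a c)
      = A.ncoef (q + 2) (A.ncoef 0 a b) c + (2 : K) • A.ncoef (q + 1) (A.ncoef 1 a b) c
        + A.ncoef q (A.ncoef 2 a b) c := by
  have h := A.commutator a b c 2 q
  rw [Finset.sum_range_succ, Finset.sum_range_succ, Finset.sum_range_one] at h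
  have h2 : zBinom K 2 2 = 1 := by
    norm_num [zBinom, Finset.prod_range_succ]
  have e1 : (2 : ℤ) + q = q + 2 := by ring
  have e2 : q + 2 - 1 = q + 1 := by ring
  simpa [zBinom_zero_right, zBinom_one_right, h2, e1, e2] using h

lemma skew_symmetry [CharZero K] (a b : V) (n : ℤ) :
    A.ncoef n b a = ∑ᶠ i : ℕ, ((-1 : K) ^ i * -((n.negOnePow : ℤ) : K)) •
      A.ncoef (-1 - i) (A.ncoef (n + i) a b) A.vac := by
  have h := A.borcherds a b A.vac n 0 (-1)
  rw [finsum_eq_single (fun i : ℕ => ((-1 : K) ^ i * zBinom K n i) • _) 0] at h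
  · simp only [zBinom_neg_one, add_zero, Nat.cast_zero, sub_zero, pow_zero,
      zBinom_zero_right, one_mul, one_smul, A.ncoef_vac, A.ncoef_vac_zero 0 le_rfl, map_zero,
      zero_sub] at h
    have hs : ((n.negOnePow : ℤ) : K) * ((n.negOnePow : ℤ) : K) = 1 := by
      have : ((n.negOnePow : ℤˣ) : ℤ) * (n.negOnePow : ℤˣ) = 1 := by
        rw [← Units.val_mul, Int.units_mul_self]; rfl
      exact_mod_cast this
    have hb : A.ncoef n b a = -((n.negOnePow : ℤ) : K) • -(((n.negOnePow : ℤ) : K) •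
        A.ncoef n b a) := by
      rw [neg_smul, smul_neg, neg_neg, smul_smul, hs, one_smul]
    rw [hb, ← h, smul_finsum]
    exact finsum_congr fun i => by rw [smul_smul, mul_comm]
  · intro i hi
    have hi' : 0 < i := Nat.pos_of_ne_zero hi
    rw [A.ncoef_vac_zero _ (by positivity), A.ncoef_vac_zero _ (by omega)]
    simp

lemma T_vac : A.T A.vac = 0 := by simp [T_apply, A.vac_ncoef]

end VA

namespace GradedVA

variable {K V : Type*} [Field K] [AddCommGroup V] [Module K V] {A : VA K V} (G : GradedVA A)

/-- The projection `pr_n` as a linear map. -/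
def proj (n : ℤ) : V →ₗ[K] V where
  toFun := G.pr n
  map_add' x y := by
    let _ := G.decomp
    simp [pr, DirectSum.decompose_add]
  map_smul' c x := by
    let _ := G.decomp
    simp only [pr, DirectSum.decompose_smul]
    rfl

lemma proj_apply (n : ℤ) (v : V) : G.proj n v = G.pr n v := rfl

lemma proj_mem (n : ℤ) (v : V) : G.proj n v ∈ G.gr n := by
  let _ := G.decomp
  exact (DirectSum.decompose G.gr v n).2

lemma proj_of_mem {n : ℤ} {v : V} (h : v ∈ G.gr n) : G.proj n v = v := by
  let _ := G.decomp
  exact DirectSum.decompose_of_mem_same G.gr h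

lemma proj_of_mem_ne {n m : ℤ} {v : V} (h : v ∈ G.gr n) (hnm : n ≠ m) : G.proj m v = 0 := by
  let _ := G.decomp
  exact DirectSum.decompose_of_mem_ne G.gr h hnm

lemma exists_sum_proj (v : V) :
    ∃ s : Finset ℤ, (∀ n, n ∉ s → G.proj n v = 0) ∧ v = ∑ n ∈ s, G.proj n v := by
  classical
  let _ := G.decomp
  refine ⟨(DirectSum.decompose G.gr v).support, fun n hn => ?_,
    (DirectSum.sum_support_decompose G.gr v).symm⟩
  have : DirectSum.decompose G.gr v n = 0 := by simpa using hn
  simp [proj_apply, pr, this]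

lemma eq_zero_of_proj {v : V} (h : ∀ n, G.proj n v = 0) : v = 0 := by
  obtain ⟨s, -, hs⟩ := G.exists_sum_proj v
  rw [hs]
  exact Finset.sum_eq_zero fun n _ => h n

@[elab_as_elim]
lemma induction_on {p : V → Prop} (v : V) (hom : ∀ n, ∀ x ∈ G.gr n, p x)
    (add : ∀ x y, p x → p y → p (x + y)) : p v := by
  let _ := G.decomp
  exact DirectSum.Decomposition.inductionOn G.gr (hom 0 0 (zero_mem _))
    (fun x => hom _ x x.2) add v

/-- Two linear maps that agree on homogeneous vectors are equal. -/
lemma linearMap_ext {M : Type*} [AddCommGroup M] [Module K M] {f g : V →ₗ[K] M}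
    (h : ∀ n, ∀ x ∈ G.gr n, f x = g x) : f = g := by
  ext v
  induction v using G.induction_on with
  | hom n x hx => exact h n x hx
  | add x y hx hy => rw [map_add, map_add, hx, hy]

lemma proj_ncoef_of_mem {j : ℤ} {c : V} (hc : c ∈ G.gr j) (i k : ℤ) (b : V) :
    G.proj (i + j - k - 1) (A.ncoef k b c) = A.ncoef k (G.proj i b) c := by
  induction b using G.induction_on with
  | hom n x hx =>
    have hm := G.ncoef_mem n j k x hx c hc
    by_cases h : n = i
    · subst h
      rw [G.proj_of_mem hm, G.proj_of_mem hx]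
    · rw [G.proj_of_mem_ne hm (by omega), G.proj_of_mem_ne hx h]
      simp
  | add x y hx hy => simp only [map_add, LinearMap.add_apply, hx, hy]

lemma T_mem {n : ℤ} {v : V} (hv : v ∈ G.gr n) : A.T v ∈ G.gr (n + 1) := by
  have := G.ncoef_mem n 0 (-2) v hv _ G.vac_mem
  rwa [show n + 0 - -2 - 1 = n + 1 by ring] at this

lemma proj_T (n : ℤ) (v : V) : G.proj (n + 1) (A.T v) = A.T (G.proj n v) := by
  have := G.proj_ncoef_of_mem G.vac_mem n (-2) v
  rwa [show n + 0 - -2 - 1 = n + 1 by ring] at this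

lemma proj_apply_of_scalar {f : V →ₗ[K] V} (hf : ∀ n, ∀ v ∈ G.gr n, f v = (n : K) • v)
    (m : ℤ) (x : V) : G.proj m (f x) = (m : K) • G.proj m x := by
  induction x using G.induction_on with
  | hom k x hx =>
    rw [hf k x hx, map_smul]
    by_cases h : k = m
    · rw [h]
    · simp [G.proj_of_mem_ne hx h]
  | add x y hx hy => simp only [map_add, smul_add, hx, hy]

/-- If `f` acts on `V_n` as the scalar `n`, then every `f`-invariant subspace is graded. -/
lemma proj_mem_of_invariant [CharZero K] {f : V →ₗ[K] V}
    (hf : ∀ n, ∀ v ∈ G.gr n, f v = (n : K) • v) {F : Submodule K V}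
    (hF : ∀ v ∈ F, f v ∈ F) (n : ℤ) {v : V} (hv : v ∈ F) : G.proj n v ∈ F := by
  classical
  have key : ∀ s : Finset ℤ, ∀ v ∈ F, (∀ m, m ∉ s → G.proj m v = 0) →
      ∀ n, G.proj n v ∈ F := by
    intro s
    induction s using Finset.induction_on with
    | empty => intro v _ h n; rw [h n (by simp)]; exact zero_mem _
    | insert m s hm ih =>
      intro v hv hs
      have hne : ∀ n, n ≠ m → G.proj n v ∈ F := by
        intro n hn
        have h0 : ((n : K) - m) ≠ 0 := sub_ne_zero.2 (by exact_mod_cast hn)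
        have hw : ∀ l, G.proj l (f v - (m : K) • v) = ((l : K) - m) • G.proj l v := by
          intro l
          rw [map_sub, map_smul, G.proj_apply_of_scalar hf, sub_smul]
        have := ih (f v - (m : K) • v) (F.sub_mem (hF v hv) (F.smul_mem _ hv))
          (fun l hl => by
            rw [hw]
            by_cases h : l = m
            · simp [h]
            · rw [hs l (by simp [h, hl]), smul_zero]) n
        rw [hw] at this
        exact (F.smul_mem_iff h0).1 this
      intro n
      by_cases hn : n = m
      · obtain ⟨t, ht, hsum⟩ := G.exists_sum_proj v
        by_cases hnt : n ∈ t
        · rw [← Finset.add_sum_erase _ _ hnt] at hsum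
          rw [eq_sub_of_add_eq hsum.symm]
          refine F.sub_mem hv (F.sum_mem fun l hl => hne l ?_)
          rw [← hn]
          exact Finset.ne_of_mem_erase hl
        · rw [ht n hnt]; exact zero_mem _
      · exact hne n hn
  obtain ⟨s, hs, -⟩ := G.exists_sum_proj v
  exact key s v hv hs n

/-- The linear map which is `pr_n` of the grading `G` on the degree `n` part of `G'`. -/
def compare (G G' : GradedVA A) : V →ₗ[K] V :=
  letI := G'.decomp
  DirectSum.toModule K ℤ V (fun n => G.proj n ∘ₗ (G'.gr n).subtype) ∘ₗ
    (DirectSum.decomposeLinearEquiv G'.gr).toLinearMap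

lemma compare_of_mem (G G' : GradedVA A) {n : ℤ} {v : V} (hv : v ∈ G'.gr n) :
    G.compare G' v = G.proj n v := by
  let _ := G'.decomp
  have : DirectSum.decompose G'.gr v = DirectSum.lof K ℤ (fun i => G'.gr i) n ⟨v, hv⟩ :=
    DirectSum.decompose_of_mem G'.gr hv
  rw [compare, LinearMap.comp_apply, LinearEquiv.coe_coe, DirectSum.decomposeLinearEquiv_apply,
    this, DirectSum.toModule_lof]
  rfl

/-- The filtration by `V_{≥k}` (for `σ = 1`) or by `V_{≤k}` (for `σ = -1`). -/
def fil (σ k : ℤ) : Submodule K V := ⨅ j : {j : ℤ // σ * j < σ * k}, LinearMap.ker (G.proj j)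

lemma mem_fil {σ k : ℤ} {v : V} : v ∈ G.fil σ k ↔ ∀ j, σ * j < σ * k → G.proj j v = 0 := by
  simp [fil, Submodule.mem_iInf]

lemma mem_fil_of_mem {σ k j : ℤ} {v : V} (hv : v ∈ G.gr j) (h : σ * k ≤ σ * j) :
    v ∈ G.fil σ k := by
  rw [mem_fil]
  intro i hi
  exact G.proj_of_mem_ne hv (by rintro rfl; omega)

lemma fil_mono {σ k l : ℤ} (h : σ * k ≤ σ * l) : G.fil σ l ≤ G.fil σ k := by
  intro v hv
  rw [mem_fil] at hv ⊢
  exact fun j hj => hv j (by omega)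

lemma proj_mem_fil {σ k : ℤ} {v : V} (hv : v ∈ G.fil σ k) (j : ℤ) :
    G.proj j v ∈ G.fil σ k := by
  rw [mem_fil] at hv ⊢
  intro i hi
  by_cases h : j = i
  · subst h; rw [hv j hi, map_zero]
  · exact G.proj_of_mem_ne (G.proj_mem j v) h

lemma ncoef_mem_fil {σ i j k : ℤ} {b c : V} (hb : b ∈ G.fil σ i) (hc : c ∈ G.fil σ j) :
    A.ncoef k b c ∈ G.fil σ (i + j - k - 1) := by
  obtain ⟨s, -, hs⟩ := G.exists_sum_proj b
  obtain ⟨t, -, ht⟩ := G.exists_sum_proj c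
  rw [hs, ht]
  simp only [map_sum, LinearMap.sum_apply]
  refine Submodule.sum_mem _ fun l _ => Submodule.sum_mem _ fun m _ => ?_
  by_cases hl : σ * l < σ * j
  · rw [(G.mem_fil).1 hc l hl]; simp
  by_cases hm : σ * m < σ * i
  · rw [(G.mem_fil).1 hb m hm]; simp
  refine G.mem_fil_of_mem (G.ncoef_mem m l k _ (G.proj_mem m b) _ (G.proj_mem l c)) ?_
  simp only [mul_add, mul_sub]
  omega

lemma ge_le_fil (n : ℤ) : G.ge n ≤ G.fil 1 n :=
  iSup₂_le fun _ hi _ hv => G.mem_fil_of_mem hv (by omega)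

lemma mem_ge_of_proj {n : ℤ} {v : V} (h : ∀ j < n, G.proj j v = 0) : v ∈ G.ge n := by
  obtain ⟨s, -, hs⟩ := G.exists_sum_proj v
  rw [hs]
  refine Submodule.sum_mem _ fun j _ => ?_
  by_cases hj : j < n
  · rw [h j hj]; exact zero_mem _
  · exact Submodule.mem_iSup_of_mem j (Submodule.mem_iSup_of_mem (by omega) (G.proj_mem j v))

lemma mem_fil_succ {σ k : ℤ} (hσ : σ = 1 ∨ σ = -1) {v : V} (hv : v ∈ G.fil σ k)
    (h : G.proj k v = 0) : v ∈ G.fil σ (k + σ) := by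
  rw [mem_fil] at hv ⊢
  intro j hj
  by_cases hjk : j = k
  · rwa [hjk]
  · exact hv j (by rcases hσ with rfl | rfl <;> omega)

lemma exists_mem_fil {σ : ℤ} (hσ : σ = 1 ∨ σ = -1) (v : V) (k : ℤ) :
    ∃ m : ℕ, v ∈ G.fil σ (k - σ * m) := by
  induction v using G.induction_on with
  | hom n x hx =>
    refine ⟨(σ * (k - n)).toNat, G.mem_fil_of_mem hx ?_⟩
    rcases hσ with rfl | rfl <;> omega
  | add x y hx hy =>
    obtain ⟨m, hm⟩ := hx
    obtain ⟨l, hl⟩ := hy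
    refine ⟨max m l, add_mem (G.fil_mono ?_ hm) (G.fil_mono ?_ hl)⟩ <;>
      rcases hσ with rfl | rfl <;> omega

lemma eq_zero_of_forall_mem_fil {σ : ℤ} (hσ : σ = 1 ∨ σ = -1) {k : ℤ} {v : V}
    (h : ∀ m : ℕ, v ∈ G.fil σ (k + σ * m)) : v = 0 := by
  refine G.eq_zero_of_proj fun j => ?_
  refine (G.mem_fil).1 (h ((σ * (j - k)).toNat + 1)) j ?_
  rcases hσ with rfl | rfl <;> push_cast <;> omega

end GradedVA

end

noncomputable section

namespace VA

variable {K V : Type*} [Field K] [AddCommGroup V] [Module K V] {A : VA K V}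

/-- The translation property `(Tb)(n+1) = -(n+1) b(n)`. -/
def TranslationRule (A : VA K V) : Prop :=
  ∀ (n : ℤ) (b : V), A.ncoef (n + 1) (A.T b) = -((n : K) + 1) • A.ncoef n b

lemma ncoef_zero_mul_vac {e : V} (he : A.ncoef 0 e = A.T) (hT : A.TranslationRule)
    (x : V) (q : ℤ) : A.T (A.ncoef q x A.vac) = -(q : K) • A.ncoef (q - 1) x A.vac := by
  have h := A.commutator_zero e x A.vac q
  rw [he, A.T_vac, map_zero, sub_zero] at h
  have h2 := hT (q - 1) x
  rw [sub_add_cancel] at h2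
  rw [h, h2]
  simp

lemma exists_ncoef_vac_eq_T [CharZero K] {e : V} (he : A.ncoef 0 e = A.T)
    (hT : A.TranslationRule) (x : V) (i : ℕ) : ∃ z, A.ncoef (-3 - i) x A.vac = A.T (A.T z) := by
  have key : ∀ i : ℕ, A.ncoef (-1 - (i + 1 : ℕ)) x A.vac
      = A.T (((i : K) + 1)⁻¹ • A.ncoef (-1 - i) x A.vac) := by
    intro i
    have h0 : (i : K) + 1 ≠ 0 := by exact_mod_cast Nat.succ_ne_zero i
    rw [map_smul, ncoef_zero_mul_vac he hT, smul_smul]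
    have : ((i : K) + 1)⁻¹ * -((-1 - (i : ℤ) : ℤ) : K) = 1 := by
      push_cast
      field_simp
      ring
    rw [this, one_smul]
    congr 3
    push_cast; ring
  have h1 := key (i + 1)
  rw [key i, ← map_smul] at h1
  refine ⟨_, Eq.trans ?_ h1⟩
  congr 3
  push_cast; ring

lemma iSupIndep_eig [CharZero K] (A : VA K V) (e : V) : iSupIndep (A.eig e) := by
  let f : Module.End K V := A.ncoef 1 e
  have h : A.eig e = f.eigenspace ∘ (Int.cast : ℤ → K) := by
    funext k
    ext v
    rw [mem_eig, Function.comp_apply, Module.End.mem_eigenspace_iff]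
  rw [h]
  exact f.eigenspaces_iSupIndep.comp Int.cast_injective

/-- The grading by the eigenspaces of `a(1)`. -/
def eigGrading (hT : A.TranslationRule) {a : V} (h0 : A.ncoef 0 a = A.T)
    (hint : DirectSum.IsInternal (A.eig a)) : GradedVA A where
  gr := A.eig a
  decomp := hint.chooseDecomposition
  vac_mem := by
    rw [mem_eig, A.ncoef_vac_zero 1 (by norm_num)]
    simp
  ncoef_mem n m k b hb c hc := by
    rw [mem_eig] at *
    have h := A.commutator_one a b c k
    rw [h0, hT k b, hb, hc, sub_eq_iff_eq_add] at h
    rw [h]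
    simp only [map_smul, LinearMap.smul_apply, ← add_smul]
    congr 1
    push_cast
    ring

namespace IsVAHom

variable {f : V → V}

lemma map_T (hf : A.IsVAHom f) (v : V) : f (A.T v) = A.T (f v) := by
  rw [T_apply, T_apply, hf.map_ncoef, hf.map_vac]

end IsVAHom

lemma IsVAAut.exists_inverse {f : V → V} (hf : A.IsVAAut f) :
    ∃ g, A.IsVAAut g ∧ ∀ v, g (f v) = v := by
  obtain ⟨g, hl, hr⟩ := Function.bijective_iff_has_inverse.1 hf.2
  refine ⟨g, ⟨⟨fun a b => ?_, fun c a => ?_, fun n a b => ?_, ?_⟩, hr.injective, hl.surjective⟩, hl⟩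
  all_goals apply hf.2.1
  · rw [hf.1.map_add, hr, hr, hr]
  · rw [hf.1.map_smul, hr, hr]
  · rw [hf.1.map_ncoef, hr, hr, hr]
  · rw [hf.1.map_vac, hr]

lemma IsVAAut.comp {f g : V → V} (hf : A.IsVAAut f) (hg : A.IsVAAut g) :
    A.IsVAAut (f ∘ g) where
  left :=
    { map_add := fun a b => by simp only [Function.comp_apply, hg.1.map_add, hf.1.map_add]
      map_smul := fun c a => by simp only [Function.comp_apply, hg.1.map_smul, hf.1.map_smul]
      map_ncoef := fun n a b => by
        simp only [Function.comp_apply, hg.1.map_ncoef, hf.1.map_ncoef]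
      map_vac := by simp only [Function.comp_apply, hg.1.map_vac, hf.1.map_vac] }
  right := hf.2.comp hg.2

lemma IsConformalCFT.map {f : V → V} (hf : A.IsVAAut f) {a : V} (ha : A.IsConformalCFT a) :
    A.IsConformalCFT (f a) := by
  let F : V ≃ₗ[K] V := LinearEquiv.ofBijective
    { toFun := f, map_add' := hf.1.map_add, map_smul' := hf.1.map_smul } hf.2
  have hF : ∀ v, F v = f v := fun _ => rfl
  have h0 : f 0 = 0 := F.map_zero
  have heig : ∀ n, A.eig (f a) n = (A.eig a n).map F.toLinearMap := by
    intro n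
    ext v
    obtain ⟨w, rfl⟩ := F.surjective v
    rw [Submodule.mem_map]
    constructor
    · intro h
      refine ⟨w, ?_, rfl⟩
      rw [mem_eig] at h ⊢
      apply hf.2.1
      rw [hf.1.map_ncoef, hf.1.map_smul]
      exact h
    · rintro ⟨u, hu, huw⟩
      have : u = w := F.injective huw
      subst this
      rw [mem_eig] at hu ⊢
      rw [hF, ← hf.1.map_ncoef, hu, hf.1.map_smul]
  obtain ⟨⟨h1, ⟨c, h3⟩, h2, h4, hT, hint⟩, hneg, hfd, hzero⟩ := ha
  refine ⟨⟨?_, ⟨c, ?_⟩, ?_, fun n hn => ?_, ?_, ?_⟩, fun n hn => ?_, fun n => ?_, ?_⟩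
  · rw [← hf.1.map_ncoef, h1, hf.1.map_smul]
  · rw [← hf.1.map_ncoef, h3, hf.1.map_smul, hf.1.map_vac]
  · rw [← hf.1.map_ncoef, h2, h0]
  · rw [← hf.1.map_ncoef, h4 n hn, h0]
  · ext v
    obtain ⟨w, rfl⟩ := hf.2.2 v
    rw [← hf.1.map_ncoef, hT, hf.1.map_T]
  · rw [DirectSum.isInternal_submodule_iff_iSupIndep_and_iSup_eq_top] at hint ⊢
    have : A.eig (f a) = fun n => Submodule.orderIsoMapComap F (A.eig a n) := by
      funext n; rw [heig]; rfl
    rw [this]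
    refine ⟨hint.1.map_orderIso (Submodule.orderIsoMapComap F), ?_⟩
    rw [← OrderIso.map_iSup, hint.2, OrderIso.map_top]
  · rw [heig, hneg n hn, Submodule.map_bot]
  · rw [heig]
    have := hfd n
    infer_instance
  · rw [heig, hzero, Submodule.map_span, Set.image_singleton]
    congr 2
    exact hf.1.map_vac

end VA

namespace GradedVA

variable {K V : Type*} [Field K] [AddCommGroup V] [Module K V] {A : VA K V} (G : GradedVA A)

lemma translationRule {e : V} (L0 : ∀ n, ∀ v ∈ G.gr n, A.ncoef 1 e v = (n : K) • v)
    (h0 : A.ncoef 0 e = A.T) : A.TranslationRule := by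
  intro n b
  induction b using G.induction_on with
  | hom j b hb =>
    refine G.linearMap_ext fun k c hc => ?_
    have h := A.commutator_one e b c n
    rw [h0, L0 j b hb, L0 k c hc, L0 _ _ (G.ncoef_mem j k n b hb c hc)] at h
    rw [← sub_eq_iff_eq_add] at h
    rw [← h]
    simp only [map_smul, LinearMap.smul_apply, ← sub_smul]
    congr 1
    push_cast
    ring
  | add x y hx hy => simp only [map_add, hx, hy, smul_add]

/-- If `e(1)` is a locally finite perturbation of the degree operator that is strictly
triangular for the filtration, then its eigenspaces form a grading isomorphic to the given
one. -/
theorem exists_aut_of_triangular [CharZero K] (hT : A.TranslationRule) {e : V}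
    (he : A.ncoef 0 e = A.T) {σ : ℤ} (hσ : σ = 1 ∨ σ = -1)
    (htri : ∀ j, ∀ v ∈ G.gr j, A.ncoef 1 e v - (j : K) • v ∈ G.fil σ (j + σ))
    (U : ℤ → Submodule K V) (hU : ⨆ i, U i = ⊤)
    (hUinv : ∀ i, ∀ v ∈ U i, A.ncoef 1 e v ∈ U i)
    (hUfil : ∀ i, ∃ N, ∀ v ∈ U i, v ∈ G.fil σ N → v = 0) :
    ∃ χ : V →ₗ[K] V, A.IsVAAut χ ∧ ∀ k, ∀ v ∈ A.eig e k, χ v = G.proj k v := by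
  have hss : σ * σ = 1 := by rcases hσ with rfl | rfl <;> rfl
  have htri' : ∀ j, ∀ v ∈ G.fil σ j, A.ncoef 1 e v - (j : K) • v ∈ G.fil σ (j + σ) := by
    intro j v hv
    obtain ⟨s, -, hs⟩ := G.exists_sum_proj v
    have : A.ncoef 1 e v - (j : K) • v
        = ∑ l ∈ s, (A.ncoef 1 e (G.proj l v) - (j : K) • G.proj l v) := by
      rw [Finset.sum_sub_distrib, ← map_sum, ← Finset.smul_sum, ← hs]
    rw [this]
    refine Submodule.sum_mem _ fun l _ => ?_
    rcases lt_trichotomy (σ * l) (σ * j) with h | h | h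
    · rw [(G.mem_fil).1 hv l h]; simp
    · have : l = j := by rcases hσ with rfl | rfl <;> omega
      subst this
      exact htri l _ (G.proj_mem l v)
    · have h1 := htri l _ (G.proj_mem l v)
      have hle : σ * (j + σ) ≤ σ * l := by rw [mul_add, hss]; omega
      have e1 : A.ncoef 1 e (G.proj l v) - (j : K) • G.proj l v
          = (A.ncoef 1 e (G.proj l v) - (l : K) • G.proj l v)
            + ((l : K) - j) • G.proj l v := by
        rw [sub_smul]; abel
      rw [e1]
      refine add_mem (G.fil_mono ?_ h1) (Submodule.smul_mem _ _
        (G.mem_fil_of_mem (G.proj_mem l v) hle))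
      rw [mul_add σ l, hss]; omega
  have hinv : ∀ j, ∀ v ∈ G.fil σ j, A.ncoef 1 e v ∈ G.fil σ j := by
    intro j v hv
    have := G.fil_mono (k := j) (by rw [mul_add, hss]; omega) (htri' j v hv)
    exact (Submodule.sub_mem_iff_left _ (Submodule.smul_mem _ _ hv)).1 this
  have hspan : ⨆ k, A.eig e k = ⊤ := by
    rw [eq_top_iff, ← hU, iSup_le_iff]
    intro i v hv
    obtain ⟨N, hN⟩ := hUfil i
    have key : ∀ m : ℕ, ∀ v ∈ U i, v ∈ G.fil σ (N - σ * m) →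
        v ∈ ⨆ k : {k : ℤ // σ * (N - σ * m) ≤ σ * k}, A.eig e k := by
      intro m
      induction m with
      | zero =>
        intro v hv hf
        rw [hN v hv (by simpa using hf)]
        exact zero_mem _
      | succ m ih =>
        intro v hv hf
        set k : ℤ := N - σ * (m + 1 : ℕ) with hk
        have hk' : N - σ * m = k + σ := by rw [hk]; push_cast; ring
        rw [hk'] at ih
        have hw := ih _ (sub_mem (hUinv i v hv) ((U i).smul_mem _ hv)) (htri' k v hf)
        have hsolve : ∀ w ∈ ⨆ l : {l : ℤ // σ * (k + σ) ≤ σ * l}, A.eig e l,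
            ∃ u ∈ ⨆ l : {l : ℤ // σ * k ≤ σ * l}, A.eig e l,
              A.ncoef 1 e u - (k : K) • u = w := by
          intro w hw
          induction hw using Submodule.iSup_induction' with
          | mem l w hw =>
            obtain ⟨l, hl'⟩ := l
            have hl := hl'
            rw [mul_add, hss] at hl
            have hlk : l ≠ k := by rintro h; rw [h] at hl; omega
            have hne : (l : K) - k ≠ 0 := sub_ne_zero.2 (by exact_mod_cast hlk)
            refine ⟨((l : K) - k)⁻¹ • w, Submodule.smul_mem _ _
              (Submodule.mem_iSup_of_mem ⟨l, by omega⟩ hw), ?_⟩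
            rw [VA.mem_eig] at hw
            rw [map_smul, hw, smul_comm (k : K), ← smul_sub, ← sub_smul, smul_smul,
              inv_mul_cancel₀ hne, one_smul]
          | zero => exact ⟨0, zero_mem _, by simp⟩
          | add x y _ _ hx hy =>
            obtain ⟨u, hu, rfl⟩ := hx
            obtain ⟨u', hu', rfl⟩ := hy
            refine ⟨u + u', add_mem hu hu', ?_⟩
            rw [map_add, smul_add]; abel
        obtain ⟨u, hu, huw⟩ := hsolve _ hw
        have hvu : v - u ∈ A.eig e k := by
          rw [VA.mem_eig, map_sub, smul_sub]
          exact sub_eq_sub_iff_sub_eq_sub.1 huw.symm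
        rw [← sub_add_cancel v u]
        exact add_mem (Submodule.mem_iSup_of_mem
          (p := fun l : {l : ℤ // σ * k ≤ σ * l} => A.eig e l) ⟨k, le_rfl⟩ hvu) hu
    obtain ⟨m, hm⟩ := G.exists_mem_fil hσ v N
    have hle : (⨆ k : {k : ℤ // σ * (N - σ * m) ≤ σ * k}, A.eig e k) ≤ ⨆ k, A.eig e k :=
      iSup_le fun k => le_iSup (A.eig e) k.1
    exact hle (key m v hv hm)
  let G' : GradedVA A := VA.eigGrading hT he
    (DirectSum.isInternal_submodule_of_iSupIndep_of_iSup_eq_top (A.iSupIndep_eig e) hspan)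
  have hG' : ∀ k, G'.gr k = A.eig e k := fun _ => rfl
  have hL0 : ∀ k, ∀ v ∈ G'.gr k, A.ncoef 1 e v = (k : K) • v := fun k v hv => A.mem_eig.1 hv
  have hstep : ∀ k j, j ≠ k → ∀ v ∈ G'.gr k, v ∈ G.fil σ j → v ∈ G.fil σ (j + σ) := by
    intro k j hjk v hv hf
    have h := htri' j v hf
    rw [hL0 k v hv, ← sub_smul] at h
    exact (Submodule.smul_mem_iff _ (sub_ne_zero.2 (by exact_mod_cast hjk.symm))).1 h
  have hlead : ∀ k, ∀ v ∈ G'.gr k, v ∈ G.fil σ k := by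
    intro k v hv
    obtain ⟨m, hm⟩ := G.exists_mem_fil hσ v k
    induction m with
    | zero => simpa using hm
    | succ m ih =>
      apply ih
      have := hstep k _ (by rcases hσ with rfl | rfl <;> push_cast <;> omega) v hv hm
      convert this using 2
      push_cast; ring
  have hinj : ∀ k, ∀ v ∈ G'.gr k, G.proj k v = 0 → v = 0 := by
    intro k v hv h0
    have h1 := G.mem_fil_succ hσ (hlead k v hv) h0
    refine G.eq_zero_of_forall_mem_fil hσ (k := k + σ) fun m => ?_
    induction m with
    | zero => simpa using h1
    | succ m ih =>
      have := hstep k _ (by rcases hσ with rfl | rfl <;> omega) v hv ih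
      convert this using 2
      push_cast; ring
  have hχ : ∀ k, ∀ v ∈ G'.gr k, G.compare G' v = G.proj k v :=
    fun k v hv => G.compare_of_mem G' hv
  refine ⟨G.compare G', ⟨⟨map_add _, map_smul _, fun n b c => ?_, ?_⟩, ?_, fun v => ?_⟩, hχ⟩
  · induction b using G'.induction_on with
    | hom i b hb =>
      induction c using G'.induction_on with
      | hom j c hc =>
        rw [hχ _ _ (G'.ncoef_mem i j n b hb c hc), hχ i b hb, hχ j c hc]
        have hb' : b - G.proj i b ∈ G.fil σ (i + σ) :=
          G.mem_fil_succ hσ (sub_mem (hlead i b hb) (G.proj_mem_fil (hlead i b hb) i))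
            (by rw [map_sub, G.proj_of_mem (G.proj_mem i b), sub_self])
        have hc' : c - G.proj j c ∈ G.fil σ (j + σ) :=
          G.mem_fil_succ hσ (sub_mem (hlead j c hc) (G.proj_mem_fil (hlead j c hc) j))
            (by rw [map_sub, G.proj_of_mem (G.proj_mem j c), sub_self])
        have e1 : A.ncoef n b c = A.ncoef n (G.proj i b) (G.proj j c)
            + (A.ncoef n (b - G.proj i b) c + A.ncoef n (G.proj i b) (c - G.proj j c)) := by
          simp only [map_sub, LinearMap.sub_apply]; abel
        have h1 := G.ncoef_mem_fil (k := n) hb' (hlead j c hc)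
        have h2 := G.ncoef_mem_fil (k := n) (G.proj_mem_fil (hlead i b hb) i) hc'
        rw [e1, map_add, map_add,
          G.proj_of_mem (G.ncoef_mem i j n _ (G.proj_mem i b) _ (G.proj_mem j c)),
          (G.mem_fil).1 h1 _ (by rcases hσ with rfl | rfl <;> omega),
          (G.mem_fil).1 h2 _ (by rcases hσ with rfl | rfl <;> omega), add_zero, add_zero]
      | add x y hx hy => simp only [map_add, hx, hy]
    | add x y hx hy => simp only [map_add, LinearMap.add_apply, hx, hy]
  · rw [hχ 0 _ G'.vac_mem, G.proj_of_mem G.vac_mem]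
  · refine (injective_iff_map_eq_zero _).2 fun v hv => G'.eq_zero_of_proj fun k => ?_
    apply hinj k _ (G'.proj_mem k v)
    have hc : G.compare G' ∘ₗ G'.proj k = G.proj k ∘ₗ G.compare G' := by
      refine G'.linearMap_ext fun j x hx => ?_
      rw [LinearMap.comp_apply, LinearMap.comp_apply, hχ j x hx]
      by_cases h : j = k
      · subst h
        rw [G'.proj_of_mem hx, hχ j x hx, G.proj_of_mem (G.proj_mem j x)]
      · rw [G'.proj_of_mem_ne hx h, map_zero, G.proj_of_mem_ne (G.proj_mem j x) h]
    rw [← hχ k _ (G'.proj_mem k v)]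
    have := LinearMap.congr_fun hc v
    simpa [hv] using this
  · change v ∈ LinearMap.range (G.compare G')
    induction v using G.induction_on with
    | hom k v hv =>
      refine ⟨G'.proj k v, ?_⟩
      rw [hχ k _ (G'.proj_mem k v)]
      have hvf : v ∈ G.fil σ k := G.mem_fil_of_mem hv le_rfl
      have hpf : ∀ j, G'.proj j v ∈ G.fil σ k := fun j =>
        G'.proj_mem_of_invariant hL0 (hinv k) j hvf
      obtain ⟨s, hs0, hs⟩ := G'.exists_sum_proj v
      have hz : ∀ j, j ≠ k → G.proj k (G'.proj j v) = 0 := by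
        intro j hj
        exact (G.mem_fil).1 (hstep j k hj.symm _ (G'.proj_mem j v) (hpf j)) k
          (by rw [mul_add, hss]; omega)
      have : G.proj k v = G.proj k (G'.proj k v) := by
        conv_lhs => rw [hs]
        rw [map_sum]
        refine Finset.sum_eq_single k (fun j _ hj => hz j hj) fun hk => ?_
        rw [hs0 k hk, map_zero]
      rw [← this, G.proj_of_mem hv]
    | add x y hx hy => exact add_mem hx hy

end GradedVA

end

noncomputable section

namespace GradedVA

variable {K V : Type*} [Field K] [AddCommGroup V] [Module K V] {A : VA K V} (G : GradedVA A)

lemma exists_fil_inf_eq_bot (U : Submodule K V) [FiniteDimensional K U] :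
    ∃ N : ℤ, ∀ v ∈ U, v ∈ G.fil 1 N → v = 0 := by
  let f : ℕ →o (Submodule K U)ᵒᵈ :=
    { toFun := fun n => OrderDual.toDual ((G.fil 1 n).comap U.subtype)
      monotone' := fun m n h => Submodule.comap_mono (f := U.subtype)
        (G.fil_mono (by rw [one_mul, one_mul]; exact_mod_cast h)) }
  obtain ⟨n, hn⟩ := IsArtinian.monotone_stabilizes f
  refine ⟨n, fun v hv hf => G.eq_zero_of_forall_mem_fil (k := n) (Or.inl rfl) fun m => ?_⟩
  have h1 : (⟨v, hv⟩ : U) ∈ (G.fil 1 (n : ℤ)).comap U.subtype := hf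
  have h2 : (G.fil 1 (n : ℤ)).comap U.subtype
      = (G.fil 1 ((n + m : ℕ) : ℤ)).comap U.subtype := hn (n + m) (by omega)
  rw [h2] at h1
  simpa using h1

section ConformalVector

variable [CharZero K] {e : V}

lemma ncoef_of_mem_one (hneg : ∀ n < 0, G.gr n = ⊥) (hzero : G.gr 0 = Submodule.span K {A.vac})
    (he : e ∈ G.gr 2) (L0 : ∀ n, ∀ v ∈ G.gr n, A.ncoef 1 e v = (n : K) • v)
    (h0 : A.ncoef 0 e = A.T) {y : V} (hy : y ∈ G.gr 1) :
    A.ncoef 0 y e = 0 ∧ A.ncoef 1 y e = y := by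
  have hy1 : A.ncoef 1 e y = y := by simpa using L0 1 y hy
  have hvac : ∀ n : ℤ, n ≠ -1 → A.ncoef n (A.ncoef 2 e y) A.vac = 0 := by
    intro n hn
    have h := G.ncoef_mem 2 1 2 e he y hy
    norm_num at h
    rw [hzero, Submodule.mem_span_singleton] at h
    obtain ⟨c, hc⟩ := h
    rw [← hc, map_smul, LinearMap.smul_apply, A.vac_ncoef, if_neg hn, smul_zero]
  have h3 : ∀ i : ℤ, 3 ≤ i → A.ncoef i e y = 0 := by
    intro i hi
    have h := G.ncoef_mem 2 1 i e he y hy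
    rwa [hneg _ (by omega), Submodule.mem_bot] at h
  constructor
  · rw [A.skew_symmetry e y 0, finsum_eq_sum_of_support_subset (s := Finset.range 2)]
    · rw [Finset.sum_range_succ, Finset.sum_range_one]
      simp [h0, hy1, A.ncoef_vac, VA.T_apply]
    · intro i hi
      by_contra hi'
      apply hi
      have : 2 ≤ i := by rw [Finset.coe_range, Set.mem_Iio] at hi'; omega
      rcases this.eq_or_lt with rfl | h
      · simp [hvac]
      · simp only [zero_add, h3 i (by omega), map_zero, LinearMap.zero_apply, smul_zero]
  · rw [A.skew_symmetry e y 1, finsum_eq_single _ 0]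
    · simp [hy1, A.ncoef_vac]
    · intro i hi
      rcases (show i = 1 ∨ 2 ≤ i by omega) with rfl | h
      · simp [hvac, show (1 : ℤ) + 1 = 2 from rfl]
      · simp only [h3 (1 + i) (by omega), map_zero, LinearMap.zero_apply, smul_zero]

lemma mem_gr_zero_of_T_eq_zero (L0 : ∀ n, ∀ v ∈ G.gr n, A.ncoef 1 e v = (n : K) • v)
    (h0 : A.ncoef 0 e = A.T) {v : V} (hv : A.T v = 0) : v ∈ G.gr 0 := by
  have hT := G.translationRule L0 h0
  have hn : ∀ n : ℤ, n ≠ -1 → A.ncoef n v = 0 := by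
    intro n hn
    have h := hT n v
    rw [hv, map_zero] at h
    have hne : -((n : K) + 1) ≠ 0 := by
      rw [neg_ne_zero]
      intro h'
      apply hn
      have : ((n + 1 : ℤ) : K) = 0 := by push_cast; exact h'
      have := Int.cast_eq_zero.1 this
      omega
    exact (smul_eq_zero.1 h.symm).resolve_left hne
  have h1 : A.ncoef 1 e v = 0 := by
    rw [A.skew_symmetry v e 1]
    refine finsum_eq_zero_of_forall_eq_zero fun i => ?_
    rw [hn (1 + i) (by omega)]
    simp
  have hp : v - G.proj 0 v = 0 := by
    refine G.eq_zero_of_proj fun n => ?_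
    rw [map_sub]
    by_cases h : n = 0
    · rw [h, G.proj_of_mem (G.proj_mem 0 v), sub_self]
    · rw [G.proj_of_mem_ne (G.proj_mem 0 v) (Ne.symm h), sub_zero]
      have h2 := G.proj_apply_of_scalar L0 n v
      rw [h1, map_zero] at h2
      exact (smul_eq_zero.1 h2.symm).resolve_left (by exact_mod_cast h)
  rw [sub_eq_zero.1 hp]
  exact G.proj_mem 0 v

lemma mem_range_T (L0 : ∀ n, ∀ v ∈ G.gr n, A.ncoef 1 e v = (n : K) • v)
    (h0 : A.ncoef 0 e = A.T) {i : ℤ} (hi0 : i ≠ 0) (hi1 : i ≠ 1) {x : V} (hx : x ∈ G.gr i)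
    (hx0 : A.ncoef 0 x = 0) : x ∈ LinearMap.range A.T := by
  have hT := G.translationRule L0 h0
  have hex : ∃ z, A.T ((((i : K) - 1) • x) + A.T z) = 0 := by
    obtain ⟨N, hN⟩ := A.trunc e x
    have h := A.skew_symmetry e x 0
    rw [hx0, finsum_eq_sum_of_support_subset (s := Finset.range (N.toNat + 1 + 1)),
      Finset.sum_range_succ', Finset.sum_range_succ'] at h
    · have hz : ∀ k : ℕ, ∃ z, ((-1 : K) ^ (k + 1 + 1) * -(((0 : ℤ).negOnePow : ℤ) : K)) •
          A.ncoef (-1 - ((k + 1 + 1 : ℕ) : ℤ)) (A.ncoef (0 + ((k + 1 + 1 : ℕ) : ℤ)) e x) A.vac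
          = A.T (A.T z) := by
        intro k
        obtain ⟨z, hz⟩ := A.exists_ncoef_vac_eq_T h0 hT
          (A.ncoef (0 + ((k + 1 + 1 : ℕ) : ℤ)) e x) k
        rw [show (-1 - ((k + 1 + 1 : ℕ) : ℤ)) = -3 - k by push_cast; ring, hz]
        exact ⟨_, by rw [map_smul, map_smul]⟩
      choose z hz using hz
      rw [Finset.sum_congr rfl fun k _ => hz k, ← map_sum, ← map_sum] at h
      refine ⟨∑ k ∈ Finset.range N.toNat, z k, ?_⟩
      have hT2 : A.ncoef (-2) x A.vac = A.T x := rfl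
      simp only [h0, L0 i x hx, A.ncoef_vac, map_sum, Nat.cast_zero, Nat.cast_one,
        Int.negOnePow_zero, Units.val_one, Int.cast_one, pow_zero, pow_one, zero_add, add_zero,
        sub_zero, one_mul, map_smul, LinearMap.smul_apply, LinearMap.zero_apply] at h
      norm_num [hT2] at h
      rw [map_add, map_smul, sub_smul, one_smul, map_sum, map_sum, h]
      abel
    · intro k hk
      by_contra hk'
      apply hk
      have : N.toNat + 2 ≤ k := by rw [Finset.coe_range, Set.mem_Iio] at hk'; omega
      simp only [hN (0 + k) (by omega), map_zero, LinearMap.zero_apply, smul_zero]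
  obtain ⟨z, hz⟩ := hex
  have hm := G.mem_gr_zero_of_T_eq_zero L0 h0 hz
  have hp := G.proj_of_mem_ne hm hi0.symm
  have hTz := G.proj_T (i - 1) z
  rw [sub_add_cancel] at hTz
  rw [map_add, map_smul, G.proj_of_mem hx, hTz] at hp
  have hne : (i : K) - 1 ≠ 0 := sub_ne_zero.2 (by exact_mod_cast hi1)
  rw [← Submodule.smul_mem_iff _ hne, eq_neg_of_add_eq_zero_left hp]
  exact neg_mem ⟨_, rfl⟩

end ConformalVector

end GradedVA

namespace VOACFT

variable {K V : Type*} [Field K] [AddCommGroup V] [Module K V] {A : VA K V}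

lemma T_mem_fil_two (W : VOACFT A) (z : V) : A.T z ∈ W.toGradedVA.fil 1 2 := by
  set G := W.toGradedVA with hG
  rw [G.mem_fil]
  intro j hj
  have h := G.proj_T (j - 1) z
  rw [sub_add_cancel] at h
  rw [h]
  have hm := G.proj_mem (j - 1) z
  rcases (show j - 1 = 0 ∨ j - 1 < 0 by omega) with h0 | h0
  · rw [h0] at hm ⊢
    rw [W.gr_zero, Submodule.mem_span_singleton] at hm
    obtain ⟨c, hc⟩ := hm
    rw [← hc, map_smul, A.T_vac, smul_zero]
  · rw [W.gr_neg _ h0, Submodule.mem_bot] at hm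
    rw [hm, map_zero]

variable [CharZero K]

theorem exists_aut_apply_eq_proj_two (W : VOACFT A) {a : V} (ha : a ∈ W.ge 2)
    (hc : A.IsConformalCFT a) :
    ∃ χ : V →ₗ[K] V, A.IsVAAut χ ∧ χ a = W.toGradedVA.proj 2 a := by
  set G := W.toGradedVA with hG
  have hT : A.TranslationRule := G.translationRule W.L0_grading W.Lneg1_eq_T
  obtain ⟨⟨h1, -, -, -, h0, hint⟩, hneg, hfd, hzero⟩ := hc
  let G' := VA.eigGrading hT h0 hint
  have L0' : ∀ n, ∀ v ∈ G'.gr n, A.ncoef 1 a v = (n : K) • v := fun n v hv => A.mem_eig.1 hv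
  have ha2 : a ∈ G'.gr 2 := A.mem_eig.2 (by simpa using h1)
  obtain ⟨e, he⟩ : ∃ e, e = G'.proj 2 W.ω := ⟨_, rfl⟩
  have he2 : e ∈ G'.gr 2 := he ▸ G'.proj_mem 2 _
  have hek : ∀ k n v, v ∈ G'.gr n → A.ncoef k e v = G'.proj (n + 1 - k) (A.ncoef k W.ω v) := by
    intro k n v hv
    rw [he, ← G'.proj_ncoef_of_mem hv 2 k, show n + 1 - k = 2 + n - k - 1 by ring]
  have he0 : A.ncoef 0 e = A.T := by
    refine G'.linearMap_ext fun n v hv => ?_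
    rw [hek 0 n v hv, W.Lneg1_eq_T]
    exact G'.proj_of_mem (by simpa using G'.T_mem hv)
  have hfil : ∀ j, ∀ v ∈ G.fil 1 j, ∀ n, G'.proj n v ∈ G.fil 1 j := by
    intro j v hv n
    refine G'.proj_mem_of_invariant L0' (fun w hw => ?_) n hv
    have := G.ncoef_mem_fil (k := 1) (G.ge_le_fil 2 ha) hw
    rwa [show (2 + j - 1 - 1 : ℤ) = j by ring] at this
  have hω : ∀ j, ∀ w ∈ G.fil 1 j, A.ncoef 1 W.ω w - (j : K) • w ∈ G.fil 1 (j + 1) := by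
    intro j w hw
    rw [G.mem_fil] at hw ⊢
    intro l hl
    rw [map_sub, map_smul, G.proj_apply_of_scalar W.L0_grading, ← sub_smul]
    by_cases h : l = j
    · rw [h, sub_self, zero_smul]
    · rw [hw l (by omega), smul_zero]
  have htri : ∀ j, ∀ v ∈ G.gr j, A.ncoef 1 e v - (j : K) • v ∈ G.fil 1 (j + 1) := by
    intro j v hv
    obtain ⟨s, -, hs⟩ := G'.exists_sum_proj v
    have : A.ncoef 1 e v - (j : K) • v = ∑ l ∈ s, G'.proj l
        (A.ncoef 1 W.ω (G'.proj l v) - (j : K) • G'.proj l v) := by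
      conv_lhs => rw [hs]
      rw [map_sum, Finset.smul_sum, ← Finset.sum_sub_distrib]
      refine Finset.sum_congr rfl fun l _ => ?_
      rw [hek 1 l _ (G'.proj_mem l v), map_sub, map_smul, G'.proj_of_mem (G'.proj_mem l v),
        add_sub_cancel_right]
    rw [this]
    exact Submodule.sum_mem _ fun l _ => hfil _ _
      (hω j _ (hfil j v (G.mem_fil_of_mem hv le_rfl) l)) l
  obtain ⟨χ, hχ, hχe⟩ := G.exists_aut_of_triangular hT he0 (Or.inl rfl) htri G'.gr
    hint.submodule_iSup_eq_top
    (fun n v hv => by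
      have := G'.ncoef_mem 2 n 1 e he2 v hv
      rwa [show (2 + n - 1 - 1 : ℤ) = n by ring] at this)
    (fun n => by
      have : FiniteDimensional K (G'.gr n) := hfd n
      exact G.exists_fil_inf_eq_bot (G'.gr n))
  refine ⟨χ, hχ, hχe 2 a ?_⟩
  obtain ⟨b, hb⟩ : ∃ b, b = e - a := ⟨_, rfl⟩
  have hb0 : A.ncoef 0 b = 0 := by rw [hb, map_sub, he0, h0, sub_self]
  have hb2 : b ∈ G'.gr 2 := hb ▸ sub_mem he2 ha2
  have hh : A.ncoef 2 a b ∈ G'.gr 1 := G'.ncoef_mem 2 2 2 a ha2 b hb2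
  have hcomm := A.commutator_two a b a 0
  have hT1 := hT 1 b
  norm_num at hT1
  rw [hb0, zero_add, zero_add, (G'.ncoef_of_mem_one hneg hzero ha2 L0' h0 hh).1, h0,
    L0' 2 _ hb2, hT1] at hcomm
  have hba : (2 : K) • A.ncoef 1 b a = 0 := by
    simp only [map_smul, LinearMap.smul_apply, LinearMap.zero_apply, LinearMap.neg_apply,
      map_zero] at hcomm
    push_cast at hcomm
    rw [← sub_eq_zero] at hcomm
    rw [← neg_eq_zero, ← hcomm]
    module
  rw [A.mem_eig, eq_add_of_sub_eq hb.symm, map_add, LinearMap.add_apply,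
    (smul_eq_zero.1 hba).resolve_left two_ne_zero, zero_add, h1]
  norm_num

/-- A vector `x` with `x(0) = 0` is, up to components of degree zero and one, a derivative. -/
lemma sub_proj_mem_range_T (W : VOACFT A) {x : V} (hx : A.ncoef 0 x = 0) :
    A.ncoef 0 (W.toGradedVA.proj 1 x) = 0 ∧
      x - W.toGradedVA.proj 0 x - W.toGradedVA.proj 1 x ∈ LinearMap.range A.T := by
  set G := W.toGradedVA with hG
  have hcomp : ∀ i, A.ncoef 0 (G.proj i x) = 0 := by
    intro i
    refine G.linearMap_ext fun j c hc => ?_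
    rw [← G.proj_ncoef_of_mem hc i 0 x, hx]
    simp
  refine ⟨hcomp 1, ?_⟩
  obtain ⟨s, -, hs⟩ := G.exists_sum_proj (x - G.proj 0 x - G.proj 1 x)
  rw [hs]
  refine Submodule.sum_mem _ fun l _ => ?_
  rw [map_sub, map_sub]
  by_cases h0 : l = 0
  · subst h0
    rw [G.proj_of_mem (G.proj_mem 0 x), G.proj_of_mem_ne (G.proj_mem 1 x) one_ne_zero]
    simp
  by_cases h1 : l = 1
  · subst h1
    rw [G.proj_of_mem (G.proj_mem 1 x), G.proj_of_mem_ne (G.proj_mem 0 x) zero_ne_one]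
    simp
  rw [G.proj_of_mem_ne (G.proj_mem 0 x) (Ne.symm h0),
    G.proj_of_mem_ne (G.proj_mem 1 x) (Ne.symm h1), sub_zero, sub_zero]
  exact G.mem_range_T W.L0_grading W.Lneg1_eq_T h0 h1 (G.proj_mem l x) (hcomp l)

theorem exists_aut_apply_mem_ge_two (W : VOACFT A) {a : V} (hc : A.IsConformalCFT a) :
    ∃ χ : V →ₗ[K] V, A.IsVAAut χ ∧ χ a ∈ W.ge 2 := by
  set G := W.toGradedVA with hG
  have hT : A.TranslationRule := G.translationRule W.L0_grading W.Lneg1_eq_T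
  obtain ⟨hy0, z, hz⟩ := W.sub_proj_mem_range_T (x := a - W.ω)
    (by rw [map_sub, hc.1.2.2.2.2.1, W.Lneg1_eq_T, sub_self])
  obtain ⟨y, hy⟩ : ∃ y, y = G.proj 1 (a - W.ω) := ⟨_, rfl⟩
  have hx0 := G.proj_mem 0 (a - W.ω)
  rw [← hG, ← hy] at hy0 hz
  have hy1 : y ∈ G.gr 1 := hy ▸ G.proj_mem 1 _
  rw [W.gr_zero, Submodule.mem_span_singleton] at hx0
  obtain ⟨c, hc0⟩ := hx0
  rw [← hc0] at hz
  obtain ⟨e, he⟩ : ∃ e, e = W.ω + y := ⟨_, rfl⟩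
  have ha : a = e + (c • A.vac + A.T z) := by rw [hz, he]; abel
  have he0 : A.ncoef 0 e = A.T := by rw [he, map_add, hy0, add_zero, W.Lneg1_eq_T]
  obtain ⟨χ, hχ, hχe⟩ := G.exists_aut_of_triangular hT he0 (Or.inr rfl)
    (fun j v hv => by
      rw [he, map_add, LinearMap.add_apply, W.L0_grading j v hv, add_sub_cancel_left]
      exact G.mem_fil_of_mem (G.ncoef_mem 1 j 1 y hy1 v hv) (by omega))
    (fun _ => ⊤) (by simp) (fun _ _ _ => Submodule.mem_top)
    (fun _ => ⟨-1, fun v _ hv => G.eq_zero_of_proj fun j => by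
      rcases lt_or_ge j 0 with hj | hj
      · have := G.proj_mem j v
        rwa [W.gr_neg j hj, Submodule.mem_bot] at this
      · exact (G.mem_fil).1 hv j (by omega)⟩)
  refine ⟨χ, hχ, ?_⟩
  have hyy : A.ncoef 1 y y ∈ G.gr 0 := by simpa using G.ncoef_mem 1 1 1 y hy1 y hy1
  rw [W.gr_zero, Submodule.mem_span_singleton] at hyy
  obtain ⟨d, hd⟩ := hyy
  have hyω := (G.ncoef_of_mem_one W.gr_neg W.gr_zero W.ω_mem W.L0_grading W.Lneg1_eq_T hy1).2
  have hωω := W.L0_grading 2 _ W.ω_mem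
  have hωy := W.L0_grading 1 _ hy1
  have hvac : χ A.vac = A.vac := hχ.1.map_vac
  have hχe' : χ e = W.ω - (d / 2) • A.vac := by
    have h2 : e + (d / 2) • A.vac ∈ A.eig e 2 := by
      rw [A.mem_eig, map_add, map_smul, A.ncoef_vac_zero 1 (by norm_num), he]
      simp only [map_add, LinearMap.add_apply, hyω, hωω, hωy, ← hd]
      push_cast
      module
    have h3 := hχe 2 _ h2
    rw [map_add, map_smul, hvac] at h3
    rw [eq_sub_iff_add_eq, h3, he, map_add, map_add, map_smul, G.proj_of_mem W.ω_mem,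
      G.proj_of_mem_ne hy1 (by norm_num), G.proj_of_mem_ne G.vac_mem (by norm_num)]
    simp
  obtain ⟨t, ht⟩ : ∃ t, t = W.ω + A.T (χ z) := ⟨_, rfl⟩
  have htf : t ∈ G.fil 1 2 :=
    ht ▸ add_mem (G.mem_fil_of_mem W.ω_mem le_rfl) (W.T_mem_fil_two _)
  have hχa : χ a = t + (c - d / 2) • A.vac := by
    rw [ha, map_add, map_add, hχe', map_smul, hvac, hχ.1.map_T, ht]
    module
  have h1 := (hc.map hχ).1.1
  have h2 : A.ncoef 1 (χ a) (χ a) ∈ G.fil 1 2 := by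
    rw [hχa]
    simp only [map_add, map_smul, LinearMap.add_apply, LinearMap.smul_apply,
      A.ncoef_vac_zero 1 zero_le_one, A.vac_ncoef]
    simpa using G.ncoef_mem_fil (k := 1) htf htf
  rw [h1, Submodule.smul_mem_iff _ two_ne_zero, G.mem_fil] at h2
  exact G.mem_ge_of_proj fun j hj => h2 j (by omega)

end VOACFT

end
/-- Lemma before Corollary `surj_cft` and Corollary `surj_cft`:
in a VOA of CFT type, if `a ∈ V_{≥2} ∩ CV_CFT` then some `ψ ∈ Aut V` satisfies
`ψ(pr_2(a)) = a`; consequently the natural map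
`(V_2 ∩ CV_CFT)/Aut_ω V → CV_CFT/Aut V` is surjective, i.e. every conformal vector of
CFT type is conjugate under `Aut V` to one lying in `V_2 ∩ CV_CFT`. -/
theorem orbit_map_surjective_CVCFT {K V : Type*} [RCLike K]
    [AddCommGroup V] [Module K V]
    (A : VA K V) (W : VOACFT A) :
    (∀ a : V, a ∈ W.ge 2 → A.IsConformalCFT a →
      ∃ ψ : V → V, A.IsVAAut ψ ∧ ψ (W.pr 2 a) = a) ∧
    (∀ a : V, A.IsConformalCFT a →
      ∃ b : V, b ∈ W.gr 2 ∧ A.IsConformalCFT b ∧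
        ∃ f : V → V, A.IsVAAut f ∧ f b = a) := by
  have conj_pr_two : ∀ a : V, a ∈ W.ge 2 → A.IsConformalCFT a →
      ∃ ψ : V → V, A.IsVAAut ψ ∧ ψ (W.pr 2 a) = a := by
    intro a ha hc
    obtain ⟨χ, hχ, hχa⟩ := W.exists_aut_apply_eq_proj_two ha hc
    obtain ⟨ψ, hψ, hψχ⟩ := hχ.exists_inverse
    refine ⟨ψ, hψ, ?_⟩
    have h := hψχ a
    rwa [hχa] at h
  refine ⟨conj_pr_two, fun a hc => ?_⟩
  obtain ⟨χ, hχ, hχa⟩ := W.exists_aut_apply_mem_ge_two hc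
  obtain ⟨ψ, hψ, hψa⟩ := conj_pr_two _ hχa (hc.map hχ)
  obtain ⟨φ, hφ, hφψ⟩ := hψ.exists_inverse
  obtain ⟨χ', hχ', hχχ'⟩ := hχ.exists_inverse
  refine ⟨W.pr 2 (χ a), W.toGradedVA.proj_mem 2 _, ?_, χ' ∘ ψ, hχ'.comp hψ, ?_⟩
  · rw [← hφψ (W.pr 2 (χ a)), hψa]
    exact (hc.map hχ).map hφ
  · rw [Function.comp_apply, hψa, hχχ']
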